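/- Let d ≥ 2 and α ∈ (−1,∞)^d. Define, for measurable f ≥ 0 and x ∈ (0,∞)^d, U^α f(x) = e^{|x|²} ∫_{(0,∞)^d} min( (|x|θ)^{−d} ∏_{i=1}^d (x_i + |x|θ)^{−2α_i−1} , (|x|+1)^d ∏_{i=1}^d (x_i + 1/(|x|+1))^{−2α_i−1} ) f(y) dν_α(y), where θ = θ(x,y) and the first expression in the minimum is interpreted as +∞ when |x|θ = 0. Then there is a constant C (depending only on d and α) such that ν_α{x ∈ (0,∞)^d : U^α f(x) > λ} ≤ (C/λ) ∫_{(0,∞)^d} f dν_α for every λ > 0 and every 0 ≤ f ∈ L¹(dν_α). -/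

import Mathlib

open MeasureTheory ENNReal

/-- The measure `ν_α` on `(0,∞)^d` with density `(∏ x_i^{2α_i+1}) e^{−|x|²}`
with respect to Lebesgue measure. -/
noncomputable def nu (d : ℕ) (α : Fin d → ℝ) : Measure (Fin d → ℝ) :=
  ((volume : Measure (Fin d → ℝ)).withDensity fun x =>
    ENNReal.ofReal ((∏ i, x i ^ (2 * α i + 1)) * Real.exp (-∑ i, x i ^ 2))).restrict
    {x | ∀ i, 0 < x i}

/-- The Euclidean norm of `x ∈ ℝ^d`. -/
noncomputable def enr (d : ℕ) (x : Fin d → ℝ) : ℝ :=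
  Real.sqrt (∑ i, x i ^ 2)

/-- The angle `θ(x,y) = arccos(⟨x,y⟩/(|x||y|))` between `x` and `y`. -/
noncomputable def theta (d : ℕ) (x y : Fin d → ℝ) : ℝ :=
  Real.arccos ((∑ i, x i * y i) / (enr d x * enr d y))

/-- The `ℝ≥0∞`-valued kernel
`min((|x|θ)^{−d} ∏ (x_i + |x|θ)^{−2α_i−1}, (|x|+1)^d ∏ (x_i + 1/(|x|+1))^{−2α_i−1})`,
the first term of the minimum being `+∞` when `|x|θ = 0` (realized via `ℝ≥0∞`-valued
powers, since `0^r = ∞` in `ℝ≥0∞` for negative real `r`). -/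
noncomputable def minker (d : ℕ) (α : Fin d → ℝ) (x y : Fin d → ℝ) : ℝ≥0∞ :=
  min
    ((ENNReal.ofReal (enr d x * theta d x y)) ^ (-(d : ℝ)) *
      ∏ i, (ENNReal.ofReal (x i + enr d x * theta d x y)) ^ (-(2 * α i + 1)))
    (ENNReal.ofReal ((enr d x + 1) ^ d *
      ∏ i, (x i + 1 / (enr d x + 1)) ^ (-(2 * α i + 1))))



lemma lintegral_pi_prod : ∀ (n : ℕ) (q : Fin n → ℝ → ℝ≥0∞), (∀ j, Measurable (q j)) →
    ∫⁻ z : Fin n → ℝ, ∏ j, q j (z j) = ∏ j, ∫⁻ v, q j v := by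
  intro n
  induction n with
  | zero =>
    intro q hq
    simp [volume_pi]
  | succ n ih =>
    intro q hq
    have h := (volume_preserving_piFinSuccAbove (fun _ : Fin (n + 1) => ℝ) 0).symm
    rw [← h.lintegral_comp (by fun_prop)]
    rw [Measure.volume_eq_prod, lintegral_prod _ (by
      apply Measurable.aemeasurable
      apply Measurable.comp (g := fun z : Fin (n+1) → ℝ => ∏ j, q j (z j)) (by fun_prop)
      exact MeasurableEquiv.measurable _)]
    simp only [Fin.prod_univ_succ, MeasurableEquiv.piFinSuccAbove_symm_apply, Fin.insertNthEquiv_apply,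
      Fin.insertNth_zero', Fin.cons_zero, Fin.cons_succ]
    simp_rw [← ih (fun j => q j.succ) (fun j => hq _)]
    rw [← lintegral_mul_const _ (hq 0)]
    congr 1
    ext u
    rw [lintegral_const_mul]
    fun_prop

lemma lintegral_tonelli (n : ℕ) (i0 : Fin (n+1)) (p : ℝ → ℝ≥0∞) (hp : Measurable p)
    (q : Fin n → ℝ → ℝ → ℝ≥0∞) (hq : ∀ j, Measurable (fun x : ℝ × ℝ => q j x.1 x.2)) :
    ∫⁻ z : Fin (n+1) → ℝ, p (z i0) * ∏ j, q j (z i0) (z (i0.succAbove j))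
      = ∫⁻ u, p u * ∏ j, ∫⁻ v, q j u v := by
  have h := (volume_preserving_piFinSuccAbove (fun _ : Fin (n + 1) => ℝ) i0).symm
  have hm : Measurable (fun z : Fin (n+1) → ℝ => p (z i0) * ∏ j, q j (z i0) (z (i0.succAbove j))) := by
    refine (hp.comp (measurable_pi_apply _)).mul (Finset.measurable_prod _ fun j _ => ?_)
    exact (hq j).comp (f := fun z : Fin (n+1) → ℝ => (z i0, z (i0.succAbove j)))
      ((measurable_pi_apply _).prodMk (measurable_pi_apply _))
  rw [← h.lintegral_comp hm]
  rw [Measure.volume_eq_prod, lintegral_prod _ (by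
      apply Measurable.aemeasurable
      exact Measurable.comp hm (MeasurableEquiv.measurable _))]
  simp only [MeasurableEquiv.piFinSuccAbove_symm_apply, Fin.insertNthEquiv_apply,
      Fin.insertNth_apply_same, Fin.insertNth_apply_succAbove]
  congr 1
  ext u
  have hq' : ∀ j, Measurable (q j u) := fun j => (hq j).comp measurable_prodMk_left
  rw [lintegral_const_mul, lintegral_pi_prod n (fun j => q j u) hq']
  fun_prop

lemma phi_anti {t1 t2 u b ε : ℝ} (h1 : 0 < t1) (h12 : t1 ≤ t2) (hu : 0 < u) (hb : 0 ≤ b) (hb1 : b ≤ 1)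
    (hε : 0 ≤ ε) : t2 ^ (-1 - ε) * (1 + t2 / u) ^ b ≤ t1 ^ (-1 - ε) * (1 + t1 / u) ^ b := by
  have key : ∀ t : ℝ, 0 < t → t ^ (-1 - ε) * (1 + t / u) ^ b = t ^ (-1 - ε + b) * (1 / t + 1 / u) ^ b := by
    intro t ht
    rw [Real.rpow_add ht, mul_assoc, ← Real.mul_rpow ht.le (by positivity)]
    congr 2
    field_simp
  have h2 : 0 < t2 := h1.trans_le h12
  rw [key _ h1, key _ h2]
  apply mul_le_mul
  · exact Real.rpow_le_rpow_of_nonpos h1 h12 (by linarith)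
  · apply Real.rpow_le_rpow (by positivity) _ hb
    gcongr
  · positivity
  · positivity

lemma one_dim_pt {u a b ε : ℝ} (hu : 0 < u) (hb : 0 ≤ b) (hb1 : b ≤ 1) (hε : 0 ≤ ε) :
    (max |u - a| 1) ^ (-1 - ε) * (1 + max |u - a| 1 / u) ^ b ≤
      2 * (2 ^ (1 + ε) * (1 + |u - a|) ^ (-(1 + ε))) + (max u 1) ^ (-1 - ε) * (1 + max u 1 / u) ^ b := by
  set t := max |u - a| 1 with ht
  have ht1 : 1 ≤ t := le_max_right _ _
  have hta : |u - a| ≤ t := le_max_left _ _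
  by_cases h : t ≤ u
  · have e1 : (1 + t / u) ^ b ≤ 2 := by
      calc (1 + t / u) ^ b ≤ 2 ^ b := by
            apply Real.rpow_le_rpow (by positivity) _ hb
            have : t / u ≤ 1 := by rw [div_le_one hu]; exact h
            linarith
        _ ≤ 2 ^ (1:ℝ) := Real.rpow_le_rpow_of_exponent_le (by norm_num) hb1
        _ = 2 := by norm_num
    have e2 : t ^ (-1 - ε) ≤ 2 ^ (1 + ε) * (1 + |u - a|) ^ (-(1 + ε)) := by
      have : t ^ (-1 - ε) ≤ ((1 + |u-a|) / 2) ^ (-1 - ε) :=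
        Real.rpow_le_rpow_of_nonpos (by positivity) (by linarith) (by linarith)
      refine this.trans (le_of_eq ?_)
      rw [Real.div_rpow (by positivity) (by norm_num), show -1 - ε = -(1+ε) by ring,
        Real.rpow_neg (x := 2) (by norm_num)]
      field_simp
    have e3 : 0 ≤ (max u 1) ^ (-1 - ε) * (1 + max u 1 / u) ^ b := by positivity
    have e4 : 0 ≤ t ^ (-1 - ε) := by positivity
    nlinarith
  · push Not at h
    have := phi_anti (t1 := max u 1) (t2 := t) (by positivity) (max_le h.le ht1) hu hb hb1 hε
    have e : 0 ≤ 2 * (2 ^ (1 + ε) * (1 + |u - a|) ^ (-(1 + ε))) := by positivity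
    linarith

lemma one_dim_one {b ε : ℝ} (hb : 0 ≤ b) (hb1 : b < 1) (hε : 0 < ε) :
    ∃ C : ℝ≥0∞, C ≠ ∞ ∧ ∀ a : ℝ, ∫⁻ u in Set.Ioi (0:ℝ), ENNReal.ofReal
      ((max |u - a| 1) ^ (-1 - ε) * (1 + max |u - a| 1 / u) ^ b) ≤ C := by
  have i1 : Integrable (fun u : ℝ => 2 * (2 ^ (1 + ε) * (1 + |u|) ^ (-(1 + ε)))) := by
    refine (Integrable.const_mul ?_ _).const_mul _
    have := integrable_one_add_norm (E := ℝ) (μ := volume) (r := 1 + ε) (by simp; exact hε)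
    simpa using this
  have i2 : IntegrableOn (fun u : ℝ => (max u 1) ^ (-1 - ε) * (1 + max u 1 / u) ^ b) (Set.Ioi 0) := by
    rw [← Set.Ioc_union_Ioi_eq_Ioi (zero_le_one (α := ℝ))]
    apply IntegrableOn.union
    · have h : IntegrableOn (fun u : ℝ => 2 * u ^ (-b)) (Set.Ioc 0 1) := by
        apply Integrable.const_mul
        have := (intervalIntegral.intervalIntegrable_rpow' (a := 0) (b := 1) (r := -b) (by linarith))
        rwa [intervalIntegrable_iff_integrableOn_Ioc_of_le zero_le_one] at this
      refine Integrable.mono' h (by fun_prop) ?_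
      filter_upwards [ae_restrict_mem measurableSet_Ioc] with u hu
      rw [Real.norm_of_nonneg (by have := hu.1; positivity), max_eq_right hu.2, Real.one_rpow, one_mul]
      calc (1 + 1 / u) ^ b ≤ (2 * u⁻¹) ^ b := by
            apply Real.rpow_le_rpow (by have := hu.1; positivity) _ hb
            have : 1 ≤ u⁻¹ := (one_le_inv₀ hu.1).2 hu.2
            rw [one_div]; linarith
        _ = 2 ^ b * u ^ (-b) := by
            rw [Real.mul_rpow (by norm_num) (by have := hu.1; positivity), Real.inv_rpow hu.1.le, Real.rpow_neg hu.1.le]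
        _ ≤ 2 * u ^ (-b) := by
            have := Real.rpow_le_rpow_of_exponent_le (x := 2) (by norm_num) hb1.le
            rw [Real.rpow_one] at this
            have := hu.1
            gcongr
    · have h : IntegrableOn (fun u : ℝ => u ^ (-1 - ε) * 2 ^ b) (Set.Ioi 1) :=
        (integrableOn_Ioi_rpow_of_lt (by linarith) one_pos).mul_const _
      refine h.congr_fun ?_ measurableSet_Ioi
      intro u hu
      have hu : 1 < u := hu
      have : u ≠ 0 := by positivity
      simp only [max_eq_left hu.le]
      rw [div_self this]; norm_num
  refine ⟨(∫⁻ u, ENNReal.ofReal (2 * (2 ^ (1 + ε) * (1 + |u|) ^ (-(1 + ε))))) +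
    ∫⁻ u in Set.Ioi (0:ℝ), ENNReal.ofReal ((max u 1) ^ (-1 - ε) * (1 + max u 1 / u) ^ b), ?_, ?_⟩
  · rw [ENNReal.add_ne_top]
    refine ⟨?_, ?_⟩
    · exact i1.lintegral_lt_top.ne
    · exact i2.lintegral_lt_top.ne
  · intro a
    calc _ ≤ ∫⁻ u in Set.Ioi (0:ℝ), (ENNReal.ofReal (2 * (2 ^ (1 + ε) * (1 + |u - a|) ^ (-(1 + ε)))) +
          ENNReal.ofReal ((max u 1) ^ (-1 - ε) * (1 + max u 1 / u) ^ b)) := by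
          refine setLIntegral_mono' measurableSet_Ioi fun u hu => ?_
          exact (ENNReal.ofReal_le_ofReal (one_dim_pt hu hb hb1.le hε.le)).trans ENNReal.ofReal_add_le
      _ = (∫⁻ u in Set.Ioi (0:ℝ), ENNReal.ofReal (2 * (2 ^ (1 + ε) * (1 + |u - a|) ^ (-(1 + ε))))) + _ :=
          lintegral_add_left (by fun_prop) _
      _ ≤ _ := by
          refine add_le_add ?_ le_rfl
          refine (setLIntegral_le_lintegral _ _).trans (le_of_eq ?_)
          exact lintegral_sub_right_eq_self (fun u => ENNReal.ofReal (2 * (2 ^ (1 + ε) * (1 + |u|) ^ (-(1 + ε))))) a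

lemma one_dim {b ε : ℝ} (hb : 0 ≤ b) (hb1 : b < 1) (hε : 0 < ε) :
    ∃ C : ℝ≥0∞, C ≠ ∞ ∧ ∀ a s : ℝ, 0 < s → ∫⁻ u in Set.Ioi (0:ℝ), ENNReal.ofReal
      (s ^ ε * (max |u - a| s) ^ (-1 - ε) * (1 + max |u - a| s / u) ^ b) ≤ C := by
  obtain ⟨C, hC, h⟩ := one_dim_one hb hb1 hε
  refine ⟨C, hC, fun a s hs => (le_of_eq ?_).trans (h (a / s))⟩
  have hmap := Real.map_volume_mul_left (a := s⁻¹) (by positivity)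
  rw [← lintegral_indicator measurableSet_Ioi, ← lintegral_indicator measurableSet_Ioi]
  have e := lintegral_map (μ := volume) (g := fun u => s⁻¹ * u) (f := (Set.Ioi (0:ℝ)).indicator fun u => ENNReal.ofReal
      ((max |u - a/s| 1) ^ (-1 - ε) * (1 + max |u - a/s| 1 / u) ^ b))
      (by refine Measurable.indicator (by fun_prop) measurableSet_Ioi) (by fun_prop)
  rw [hmap, lintegral_smul_measure, inv_inv, abs_of_pos hs] at e
  have hs' : ENNReal.ofReal s ≠ 0 := by simpa using hs
  have e' := congrArg (fun x => (ENNReal.ofReal s)⁻¹ * x) e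
  simp only [smul_eq_mul, ← mul_assoc, ENNReal.inv_mul_cancel hs' ENNReal.ofReal_ne_top, one_mul] at e'
  rw [e', ← lintegral_const_mul' _ _ (by simpa using hs)]
  congr 1
  ext u
  by_cases hu : 0 < u
  · rw [Set.indicator_of_mem (by exact hu), Set.indicator_of_mem (by simp only [Set.mem_Ioi]; positivity),
      ← ENNReal.ofReal_inv_of_pos hs, ← ENNReal.ofReal_mul (by positivity)]
    congr 1
    have e1 : max |s⁻¹ * u - a / s| 1 = max |u - a| s / s := by
      rw [← max_div_div_right hs.le, div_self hs.ne', ← abs_of_pos hs, ← abs_div, abs_of_pos hs]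
      congr 2
      field_simp
    rw [e1, Real.div_rpow (by positivity) hs.le]
    have e2 : max |u - a| s / s / (s⁻¹ * u) = max |u - a| s / u := by field_simp
    rw [e2]
    have e3 : s ^ (-1 - ε) = s⁻¹ * (s^ε)⁻¹ := by
      rw [Real.rpow_sub hs, Real.rpow_neg_one]; rfl
    rw [e3]
    field_simp
  · have : ¬ 0 < s⁻¹ * u := by
      push Not at hu ⊢
      exact mul_nonpos_of_nonneg_of_nonpos (by positivity) hu
    rw [Set.indicator_of_notMem (by exact hu), Set.indicator_of_notMem (by exact this), mul_zero]


lemma lagrange (d : ℕ) (z y : Fin d → ℝ) (i j : Fin d) :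
    (z j * y i - z i * y j) ^ 2 ≤ 2 * ((∑ i, z i ^ 2) * (∑ i, y i ^ 2) - (∑ i, z i * y i) ^ 2) := by
  have h : 2 * ((∑ i, z i ^ 2) * (∑ i, y i ^ 2) - (∑ i, z i * y i) ^ 2) =
      ∑ i, ∑ j, (z j * y i - z i * y j) ^ 2 := by
    have e1 : (∑ i, z i ^ 2) * (∑ i, y i ^ 2) = ∑ i, ∑ j, z j ^ 2 * y i ^ 2 := by
      rw [mul_comm, Finset.sum_mul_sum]
      exact Finset.sum_congr rfl fun _ _ => Finset.sum_congr rfl fun _ _ => mul_comm _ _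
    have e2 : (∑ i, z i ^ 2) * (∑ i, y i ^ 2) = ∑ i, ∑ j, z i ^ 2 * y j ^ 2 := by
      rw [Finset.sum_mul_sum]
    have e3 : (∑ i, z i * y i) ^ 2 = ∑ i, ∑ j, (z i * y i) * (z j * y j) := by
      rw [sq, Finset.sum_mul_sum]
    calc _ = (∑ i, z i ^ 2) * (∑ i, y i ^ 2) + (∑ i, z i ^ 2) * (∑ i, y i ^ 2)
            - 2 * (∑ i, z i * y i) ^ 2 := by ring
      _ = ∑ i, ∑ j, (z j ^ 2 * y i ^ 2 + z i ^ 2 * y j ^ 2 - 2 * ((z i * y i) * (z j * y j))) := by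
        nth_rw 1 [e1]
        rw [e2, e3]
        simp only [Finset.sum_sub_distrib, Finset.sum_add_distrib, Finset.mul_sum]
      _ = _ := Finset.sum_congr rfl fun _ _ => Finset.sum_congr rfl fun _ _ => by ring
  rw [h]
  calc _ ≤ ∑ j, (z j * y i - z i * y j) ^ 2 :=
        Finset.single_le_sum (f := fun j => (z j * y i - z i * y j) ^ 2) (fun _ _ => sq_nonneg _) (Finset.mem_univ j)
    _ ≤ _ := Finset.single_le_sum (f := fun i => ∑ j, (z j * y i - z i * y j) ^ 2)
        (fun _ _ => Finset.sum_nonneg fun _ _ => sq_nonneg _) (Finset.mem_univ i)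

lemma enr_sq (d : ℕ) (z : Fin d → ℝ) : enr d z ^ 2 = ∑ i, z i ^ 2 :=
  Real.sq_sqrt (Finset.sum_nonneg fun _ _ => sq_nonneg _)

lemma enr_nonneg (d : ℕ) (z : Fin d → ℝ) : 0 ≤ enr d z := Real.sqrt_nonneg _

lemma le_enr (d : ℕ) (z : Fin d → ℝ) (i : Fin d) : z i ≤ enr d z := by
  apply Real.le_sqrt_of_sq_le
  exact Finset.single_le_sum (f := fun i => z i ^ 2) (fun _ _ => sq_nonneg _) (Finset.mem_univ i)

lemma geo (d : ℕ) (z y : Fin d → ℝ) (hz : 0 < enr d z) (hy : 0 < enr d y) (i j : Fin d) :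
    |z j * y i - z i * y j| ≤ 2 * (enr d z * enr d y * theta d z y) := by
  have h := lagrange d z y i j
  rw [← enr_sq, ← enr_sq] at h
  have hth : 0 ≤ theta d z y := Real.arccos_nonneg _
  have hsin : Real.sin (theta d z y) ≤ theta d z y := Real.sin_le hth
  have hsin0 : 0 ≤ Real.sin (theta d z y) := Real.sin_nonneg_of_nonneg_of_le_pi hth (Real.arccos_le_pi _)
  set S := ∑ i, z i * y i
  set P := enr d z
  set Q := enr d y
  have hSS : S ^ 2 ≤ P ^ 2 * Q ^ 2 := by nlinarith [sq_nonneg (z j * y i - z i * y j)]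
  have hs2 : Real.sin (theta d z y) ^ 2 = 1 - (S / (P * Q)) ^ 2 := by
    rw [theta, Real.sin_arccos, Real.sq_sqrt]
    rw [div_pow, mul_pow, sub_nonneg, div_le_one (by positivity)]
    exact hSS
  have e : P ^ 2 * Q ^ 2 - S ^ 2 = (P * Q * Real.sin (theta d z y)) ^ 2 := by
    rw [mul_pow, hs2]; field_simp
  rw [e] at h
  have h2 : |z j * y i - z i * y j| ≤ 2 * (P * Q * Real.sin (theta d z y)) := by
    apply abs_le_of_sq_le_sq _ (by positivity)
    nlinarith [sq_nonneg (P * Q * Real.sin (theta d z y))]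
  refine h2.trans ?_
  gcongr

lemma enr_le_max (d : ℕ) (y : Fin d → ℝ) (i : Fin d) (hy : ∀ j, 0 < y j) (h : ∀ j, y j ≤ y i) :
    enr d y ≤ d * y i := by
  apply Real.sqrt_le_iff.2 ⟨mul_nonneg (by positivity) (hy i).le, ?_⟩
  have h1 : ∑ j, y j ^ 2 ≤ ∑ _j : Fin d, y i ^ 2 := Finset.sum_le_sum fun j _ => by
    have := hy j; have := h j; gcongr
  have : (1:ℝ) ≤ d := by
    have : 0 < d := i.pos
    exact_mod_cast this
  simp at h1
  have := hy i
  calc _ ≤ _ := h1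
    _ ≤ ((d:ℝ) * d) * y i ^ 2 := by gcongr; nlinarith
    _ = _ := by ring

lemma geo' (d : ℕ) (z y : Fin d → ℝ) (hz : 0 < enr d z) (hy : ∀ j, 0 < y j) (i j : Fin d)
    (h : ∀ j, y j ≤ y i) :
    |z j - y j / y i * z i| ≤ 2 * d * (enr d z * theta d z y) := by
  have hy0 : 0 < enr d y := (hy i).trans_le (le_enr d y i)
  have h1 := geo d z y hz hy0 i j
  have h2 := enr_le_max d y i hy h
  have hi := hy i
  have hth : 0 ≤ theta d z y := Real.arccos_nonneg _
  have e : z j - y j / y i * z i = (z j * y i - z i * y j) / y i := by field_simp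
  rw [e, abs_div, abs_of_pos hi, div_le_iff₀ hi]
  refine h1.trans ?_
  calc 2 * (enr d z * enr d y * theta d z y) = (2 * enr d z * theta d z y) * enr d y := by ring
    _ ≤ (2 * enr d z * theta d z y) * (d * y i) := by gcongr
    _ = _ := by ring

noncomputable def Wk (d : ℕ) (β : Fin d → ℝ) (s : ℝ) (z y : Fin d → ℝ) : ℝ :=
  (enr d z * max (theta d z y) s) ^ (-(d:ℝ)) * ∏ i, (z i + enr d z * max (theta d z y) s) ^ (-β i)

lemma factor_le {T s K m v b ε : ℝ} (hs : 0 < s) (hK : 1 ≤ K) (hm : 0 < m) (hT : m / K ≤ T) (hv : 0 < v)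
    (hb : 0 ≤ b) (hb1 : b ≤ 1) (hε : 0 ≤ ε) (hε1 : ε ≤ 1) :
    s ^ ε * T ^ (-1 - ε) * (1 + T / v) ^ b ≤ K ^ 2 * (s ^ ε * m ^ (-1 - ε) * (1 + m / v) ^ b) := by
  have hK0 : 0 < K := by linarith
  have h1 := phi_anti (t1 := m / K) (by positivity) hT hv hb hb1 hε
  have h2 : (m / K) ^ (-1 - ε) * (1 + m / K / v) ^ b ≤ K ^ 2 * (m ^ (-1 - ε) * (1 + m / v) ^ b) := by
    have e1 : (m / K) ^ (-1 - ε) = K ^ (1 + ε) * m ^ (-1 - ε) := by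
      rw [Real.div_rpow hm.le hK0.le, show -1 - ε = -(1+ε) by ring, Real.rpow_neg (x := K) hK0.le]
      field_simp
    have e2 : K ^ (1 + ε) ≤ K ^ 2 := by
      rw [← Real.rpow_natCast K 2]
      exact Real.rpow_le_rpow_of_exponent_le hK (by push_cast; linarith)
    have e3 : (1 + m / K / v) ^ b ≤ (1 + m / v) ^ b := by
      apply Real.rpow_le_rpow (by positivity) _ hb
      gcongr
      exact div_le_self hm.le hK
    rw [e1, ← mul_assoc]
    gcongr
  calc _ = s ^ ε * (T ^ (-1 - ε) * (1 + T / v) ^ b) := by ring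
    _ ≤ s ^ ε * (K ^ 2 * (m ^ (-1 - ε) * (1 + m / v) ^ b)) := by
      exact mul_le_mul_of_nonneg_left (h1.trans h2) (by positivity)
    _ = _ := by ring

lemma key_pt (n : ℕ) (hn : 1 ≤ n) (β : Fin (n+1) → ℝ) (b : ℝ) (hb : 0 ≤ b) (hb1 : b < 1)
    (hβ : ∀ i, -β i ≤ b) (z : Fin (n+1) → ℝ) (hz : ∀ i, 0 < z i) (i0 : Fin (n+1)) (T s K : ℝ) (hs : 0 < s)
    (hK : 1 ≤ K) (hT7 : T ≤ 7) (hT0 : 0 < T) (m : Fin n → ℝ) (hm : ∀ j, 0 < m j) (hmT : ∀ j, m j / K ≤ T) :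
    s * ((T ^ (-((n+1:ℕ):ℝ)) * ∏ i, (z i + T) ^ (-β i)) * ∏ i, z i ^ β i) ≤
      (1 + 7 / z i0) ^ b * ∏ j : Fin n, (K ^ 2 * (s ^ (1 / (n:ℝ)) * (m j) ^ (-1 - 1 / (n:ℝ)) *
        (1 + m j / z (i0.succAbove j)) ^ b)) := by
  have hn0 : (1:ℝ) ≤ n := by exact_mod_cast hn
  have h1 : (∏ i, (z i + T) ^ (-β i)) * ∏ i, z i ^ β i ≤ ∏ i, (1 + T / z i) ^ b := by
    rw [← Finset.prod_mul_distrib]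
    refine Finset.prod_le_prod (fun i _ => by have := hz i; positivity) fun i _ => ?_
    have hzi := hz i
    have e : (z i + T) ^ (-β i) * z i ^ β i = (1 + T / z i) ^ (-β i) := by
      rw [show 1 + T / z i = (z i + T) / z i by field_simp, Real.div_rpow (by positivity) hzi.le,
        Real.rpow_neg (x := z i) hzi.le]
      field_simp
    rw [e]
    exact Real.rpow_le_rpow_of_exponent_le (by have : 0 < T / z i := by positivity
                                               linarith) (hβ i)
  have h2 : s * T ^ (-((n+1:ℕ):ℝ)) = ∏ _j : Fin n, (s ^ (1 / (n:ℝ)) * T ^ (-1 - 1/(n:ℝ))) := by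
    rw [Finset.prod_const, Finset.card_univ, Fintype.card_fin, mul_pow, ← Real.rpow_natCast, ← Real.rpow_natCast,
      ← Real.rpow_mul hs.le, ← Real.rpow_mul hT0.le]
    have : (1 / (n:ℝ)) * n = 1 := by field_simp
    rw [this, Real.rpow_one]
    congr 2
    push_cast
    field_simp
    ring
  calc _ = (s * T ^ (-((n+1:ℕ):ℝ))) * ((∏ i, (z i + T) ^ (-β i)) * ∏ i, z i ^ β i) := by ring
    _ ≤ (s * T ^ (-((n+1:ℕ):ℝ))) * ∏ i, (1 + T / z i) ^ b := by gcongr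
    _ = (1 + T / z i0) ^ b * ∏ j : Fin n, (s ^ (1 / (n:ℝ)) * T ^ (-1 - 1/(n:ℝ)) * (1 + T / z (i0.succAbove j)) ^ b) := by
      rw [h2, Fin.prod_univ_succAbove _ i0, Finset.prod_mul_distrib (g := fun j => (1 + T / z (i0.succAbove j)) ^ b)]
      ring
    _ ≤ _ := by
      have hzi := hz i0
      refine mul_le_mul ?_ ?_ ?_ (by positivity)
      · apply Real.rpow_le_rpow (by positivity) _ hb
        gcongr
      · refine Finset.prod_le_prod (fun j _ => by have := hz (i0.succAbove j); positivity) fun j _ => ?_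
        exact factor_le hs hK (hm j) (hmT j) (hz _) hb hb1.le (by positivity) (by rw [div_le_one (by positivity)]; exact hn0)
      · exact Finset.prod_nonneg fun j _ => by have := hz (i0.succAbove j); positivity

lemma pbound {b : ℝ} (hb : 0 ≤ b) (hb1 : b < 1) :
    ∫⁻ u in Set.Ioo (0:ℝ) 2, ENNReal.ofReal ((1 + 7 / u) ^ b) ≠ ∞ := by
  have h : IntegrableOn (fun u : ℝ => 9 ^ b * u ^ (-b)) (Set.Ioo 0 2) := by
    apply Integrable.const_mul
    have := (intervalIntegral.intervalIntegrable_rpow' (a := 0) (b := 2) (r := -b) (by linarith))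
    rw [intervalIntegrable_iff_integrableOn_Ioc_of_le zero_le_two] at this
    exact this.mono_set Set.Ioo_subset_Ioc_self
  refine ne_top_of_le_ne_top h.lintegral_lt_top.ne (setLIntegral_mono' measurableSet_Ioo fun u hu => ?_)
  have hu0 := hu.1
  have hu2 := hu.2
  apply ENNReal.ofReal_le_ofReal
  rw [Real.rpow_neg hu0.le, ← Real.inv_rpow hu0.le, ← Real.mul_rpow (by norm_num) (by positivity)]
  apply Real.rpow_le_rpow (by positivity) _ hb
  rw [← div_eq_mul_inv, show 1 + 7 / u = (u + 7) / u by field_simp]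
  gcongr
  linarith

def annu (d : ℕ) : Set (Fin d → ℝ) := {z | (∀ i, 0 < z i) ∧ 1 < enr d z ∧ enr d z < 2}

lemma meas_enr (d : ℕ) : Measurable (enr d) := by unfold enr; fun_prop

lemma meas_pos (d : ℕ) : MeasurableSet {x : Fin d → ℝ | ∀ i, 0 < x i} := by
  rw [Set.ofPred_forall]
  exact MeasurableSet.iInter fun i => measurableSet_lt measurable_const (measurable_pi_apply i)

lemma meas_annu (d : ℕ) : MeasurableSet (annu d) := by
  have h := meas_enr d
  exact (meas_pos d).inter ((measurableSet_lt measurable_const h).inter (measurableSet_lt h measurable_const))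

lemma key_est (d : ℕ) (hd : 2 ≤ d) (β : Fin d → ℝ) (hβ : ∀ i, -1 < β i) :
    ∃ C : ℝ≥0∞, C ≠ ∞ ∧ ∀ y : Fin d → ℝ, (∀ i, 0 < y i) → ∀ s : ℝ, 0 < s → s ≤ 1 →
      ENNReal.ofReal s * ∫⁻ z in annu d, ENNReal.ofReal (Wk d β s z y * ∏ i, z i ^ β i) ≤ C := by
  obtain ⟨n, rfl⟩ : ∃ n, d = n + 1 := ⟨d - 1, by omega⟩
  have hn : 1 ≤ n := by omega
  obtain ⟨b, hb, hb1, hβb⟩ : ∃ b : ℝ, 0 ≤ b ∧ b < 1 ∧ ∀ i, -β i ≤ b := by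
    obtain ⟨i, hi⟩ := Finite.exists_max (fun i => -β i)
    exact ⟨max (-β i) 0, le_max_right _ _, max_lt (by linarith [hβ i]) one_pos,
      fun j => (hi j).trans (le_max_left _ _)⟩
  have hn0 : (0:ℝ) < 1 / n := by positivity
  obtain ⟨C, hC, h1⟩ := one_dim hb hb1 hn0
  set K : ℝ := 2 * ((n+1:ℕ):ℝ) with hKdef
  have hK : 1 ≤ K := by rw [hKdef]; push_cast; linarith [(Nat.cast_nonneg n : (0:ℝ) ≤ n)]
  refine ⟨(∫⁻ u in Set.Ioo (0:ℝ) 2, ENNReal.ofReal ((1 + 7 / u) ^ b)) * (ENNReal.ofReal (K^2) * C) ^ n,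
    ENNReal.mul_ne_top (pbound hb hb1) (ENNReal.pow_ne_top (ENNReal.mul_ne_top ENNReal.ofReal_ne_top hC)), ?_⟩
  intro y hy s hs hs1
  obtain ⟨i0, hi0⟩ := Finite.exists_max y
  let p : ℝ → ℝ≥0∞ := (Set.Ioo (0:ℝ) 2).indicator fun u => ENNReal.ofReal ((1 + 7 / u) ^ b)
  let c : Fin n → ℝ := fun j => y (i0.succAbove j) / y i0
  let q : Fin n → ℝ → ℝ → ℝ≥0∞ := fun j u v => (Set.Ioi (0:ℝ)).indicator (fun v => ENNReal.ofReal (K ^ 2 *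
    (s ^ (1 / (n:ℝ)) * (max |v - c j * u| s) ^ (-1 - 1 / (n:ℝ)) * (1 + max |v - c j * u| s / v) ^ b))) v
  have hp : Measurable p := Measurable.indicator (by fun_prop) measurableSet_Ioo
  have hq : ∀ j, Measurable (fun x : ℝ × ℝ => q j x.1 x.2) := by
    intro j
    exact Measurable.indicator (s := {x : ℝ × ℝ | 0 < x.2}) (f := fun x : ℝ × ℝ => ENNReal.ofReal (K ^ 2 *
      (s ^ (1 / (n:ℝ)) * (max |x.2 - c j * x.1| s) ^ (-1 - 1 / (n:ℝ)) * (1 + max |x.2 - c j * x.1| s / x.2) ^ b)))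
      (by fun_prop) (measurableSet_lt measurable_const measurable_snd)
  rw [← lintegral_const_mul' _ _ ENNReal.ofReal_ne_top]
  calc _ ≤ ∫⁻ z in annu (n+1), p (z i0) * ∏ j, q j (z i0) (z (i0.succAbove j)) := by
        refine setLIntegral_mono' (meas_annu _) fun z hz => ?_
        obtain ⟨hz0, hz1, hz2⟩ := hz
        have hpz : p (z i0) = ENNReal.ofReal ((1 + 7 / z i0) ^ b) :=
          Set.indicator_of_mem (s := Set.Ioo (0:ℝ) 2) ⟨hz0 i0, (le_enr _ z i0).trans_lt hz2⟩ _
        have hqz : ∀ j, q j (z i0) (z (i0.succAbove j)) = ENNReal.ofReal (K ^ 2 *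
          (s ^ (1 / (n:ℝ)) * (max |z (i0.succAbove j) - c j * z i0| s) ^ (-1 - 1 / (n:ℝ)) *
          (1 + max |z (i0.succAbove j) - c j * z i0| s / z (i0.succAbove j)) ^ b)) := fun j =>
          Set.indicator_of_mem (hz0 _) _
        rw [hpz, Finset.prod_congr rfl fun j _ => hqz j, ← ENNReal.ofReal_prod_of_nonneg, ← ENNReal.ofReal_mul hs.le, ← ENNReal.ofReal_mul]
        · apply ENNReal.ofReal_le_ofReal
          have hth : 0 ≤ theta (n+1) z y := Real.arccos_nonneg _
          have hth2 : theta (n+1) z y ≤ 3.15 := (Real.arccos_le_pi _).trans Real.pi_lt_d2.le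
          have hM : max (theta (n+1) z y) s ≤ 3.15 := max_le hth2 (by linarith)
          have hM0 : 0 < max (theta (n+1) z y) s := lt_max_of_lt_right hs
          apply key_pt n hn β b hb hb1 hβb z hz0 i0 _ s K hs hK
          · nlinarith
          · positivity
          · exact fun j => lt_max_of_lt_right hs
          · intro j
            rw [div_le_iff₀ (by linarith)]
            apply max_le
            · refine (geo' (n+1) z y (by linarith) hy i0 (i0.succAbove j) hi0).trans ?_
              rw [← hKdef, mul_comm]
              gcongr
              exact le_max_left _ _
            · have : s ≤ max (theta (n+1) z y) s := le_max_right _ _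
              calc s ≤ max (theta (n+1) z y) s := this
                _ ≤ enr (n+1) z * max (theta (n+1) z y) s := le_mul_of_one_le_left hM0.le hz1.le
                _ ≤ _ := le_mul_of_one_le_right (by positivity) hK
        · have := hz0 i0; positivity
        · intro j _; have := hz0 (i0.succAbove j); positivity
    _ ≤ ∫⁻ z : Fin (n+1) → ℝ, p (z i0) * ∏ j, q j (z i0) (z (i0.succAbove j)) := setLIntegral_le_lintegral _ _
    _ = ∫⁻ u, p u * ∏ j, ∫⁻ v, q j u v := lintegral_tonelli n i0 p hp q hq
    _ ≤ ∫⁻ u, p u * (ENNReal.ofReal (K^2) * C) ^ n := by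
        refine lintegral_mono fun u => ?_
        refine mul_le_mul_right ?_ _
        calc _ ≤ ∏ _j : Fin n, (ENNReal.ofReal (K^2) * C) := by
              refine Finset.prod_le_prod' fun j _ => ?_
              simp only [q]
              rw [lintegral_indicator measurableSet_Ioi]
              simp_rw [ENNReal.ofReal_mul (sq_nonneg K)]
              rw [lintegral_const_mul' _ _ ENNReal.ofReal_ne_top]
              exact mul_le_mul_right (h1 _ s hs) _
          _ = _ := by simp
    _ = _ := by
        rw [lintegral_mul_const _ hp, lintegral_indicator measurableSet_Ioo]


lemma lint_scale (d : ℕ) (g : (Fin d → ℝ) → ℝ≥0∞) (hg : Measurable g) (t : ℝ) (ht : 0 < t) :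
    ∫⁻ x, g x = ENNReal.ofReal (t ^ d) * ∫⁻ z, g (t • z) := by
  have hmap := Measure.map_addHaar_smul (volume : Measure (Fin d → ℝ)) ht.ne'
  have e := lintegral_map (μ := volume) (g := fun z : Fin d → ℝ => t • z) hg (by fun_prop)
  rw [hmap, lintegral_smul_measure, Module.finrank_fin_fun, abs_of_pos (by positivity)] at e
  rw [← e, smul_eq_mul, ← mul_assoc, ← ENNReal.ofReal_mul (by positivity), mul_inv_cancel₀ (by positivity)]
  simp

lemma enr_smul (d : ℕ) (t : ℝ) (ht : 0 ≤ t) (z : Fin d → ℝ) : enr d (t • z) = t * enr d z := by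
  unfold enr
  simp only [Pi.smul_apply, smul_eq_mul, mul_pow, ← Finset.mul_sum]
  rw [Real.sqrt_mul (by positivity), Real.sqrt_sq ht]

lemma theta_smul (d : ℕ) (t : ℝ) (ht : 0 < t) (z y : Fin d → ℝ) : theta d (t • z) y = theta d z y := by
  unfold theta
  rw [enr_smul d t ht.le]
  simp only [Pi.smul_apply, smul_eq_mul, mul_assoc, ← Finset.mul_sum]
  rw [mul_div_mul_left _ _ ht.ne']

lemma prod_rpow_smul (d : ℕ) (β : Fin d → ℝ) (t : ℝ) (ht : 0 < t) (z : Fin d → ℝ) (hz : ∀ i, 0 < z i) :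
    ∏ i, (t * z i) ^ β i = t ^ (∑ i, β i) * ∏ i, z i ^ β i := by
  rw [Real.rpow_sum_of_pos ht, ← Finset.prod_mul_distrib]
  exact Finset.prod_congr rfl fun i _ => Real.mul_rpow ht.le (hz i).le

lemma Wk_smul (d : ℕ) (β : Fin d → ℝ) (s : ℝ) (hs : 0 < s) (t : ℝ) (ht : 0 < t) (z y : Fin d → ℝ)
    (hz : ∀ i, 0 < z i) : Wk d β s (t • z) y = t ^ (-(d + ∑ i, β i)) * Wk d β s z y := by
  unfold Wk
  rw [theta_smul d t ht, enr_smul d t ht.le]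
  have hM : 0 < max (theta d z y) s := lt_max_of_lt_right hs
  have hT : 0 ≤ enr d z * max (theta d z y) s := mul_nonneg (enr_nonneg d z) hM.le
  rw [mul_assoc, Real.mul_rpow ht.le hT]
  have := prod_rpow_smul d (fun i => -β i) t ht (fun i => z i + enr d z * max (theta d z y) s)
    (fun i => by have := hz i; positivity)
  simp only [Pi.smul_apply, smul_eq_mul, ← mul_add]
  rw [this, neg_add, Real.rpow_add ht, Finset.sum_neg_distrib]
  ring

lemma meas_theta (d : ℕ) : Measurable (fun p : (Fin d → ℝ) × (Fin d → ℝ) => theta d p.1 p.2) := by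
  unfold theta
  have := meas_enr d
  have h1 : Measurable (fun p : (Fin d → ℝ) × (Fin d → ℝ) => enr d p.1) := this.comp measurable_fst
  have h2 : Measurable (fun p : (Fin d → ℝ) × (Fin d → ℝ) => enr d p.2) := this.comp measurable_snd
  exact Real.continuous_arccos.measurable.comp (by fun_prop)

lemma meas_Wk (d : ℕ) (β : Fin d → ℝ) (s : ℝ) :
    Measurable (fun p : (Fin d → ℝ) × (Fin d → ℝ) => Wk d β s p.1 p.2) := by
  unfold Wk
  have := meas_enr d
  have h1 : Measurable (fun p : (Fin d → ℝ) × (Fin d → ℝ) => enr d p.1) := this.comp measurable_fst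
  have h2 := meas_theta d
  fun_prop

lemma half_bound (d : ℕ) (hd : 2 ≤ d) (x : Fin d → ℝ) (hx : ∀ i, 0 < x i) :
    1 ≤ 2 * ∫⁻ t in Set.Ioi (0:ℝ), ENNReal.ofReal t⁻¹ * (annu d).indicator 1 (t⁻¹ • x) := by
  have hr : 0 < enr d x := (hx ⟨0, by omega⟩).trans_le (le_enr d x _)
  set r := enr d x with hrdef
  calc (1:ℝ≥0∞) = 2 * ∫⁻ _t in Set.Ioo (r/2) r, ENNReal.ofReal r⁻¹ := by
        rw [setLIntegral_const, Real.volume_Ioo, ← ENNReal.ofReal_mul (by positivity),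
          show (2:ℝ≥0∞) = ENNReal.ofReal 2 by simp, ← ENNReal.ofReal_mul (by norm_num),
          show 2 * (r⁻¹ * (r - r/2)) = 1 by field_simp; norm_num]
        simp
    _ ≤ 2 * ∫⁻ t in Set.Ioo (r/2) r, ENNReal.ofReal t⁻¹ * (annu d).indicator 1 (t⁻¹ • x) := by
        refine mul_le_mul_right (setLIntegral_mono' measurableSet_Ioo fun t ht => ?_) _
        have ht0 : 0 < t := by linarith [ht.1]
        have : t⁻¹ • x ∈ annu d := by
          refine ⟨fun i => by have := hx i; simp only [Pi.smul_apply, smul_eq_mul]; positivity, ?_, ?_⟩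
          · rw [enr_smul d _ (by positivity), ← hrdef, inv_mul_eq_div, one_lt_div ht0]; exact ht.2
          · rw [enr_smul d _ (by positivity), ← hrdef, inv_mul_eq_div, div_lt_iff₀ ht0]; linarith [ht.1]
        rw [Set.indicator_of_mem this, Pi.one_apply, mul_one]
        apply ENNReal.ofReal_le_ofReal
        exact inv_anti₀ ht0 ht.2.le
    _ ≤ _ := by
        refine mul_le_mul_right (lintegral_mono_set ?_) _
        intro t ht
        exact lt_trans (by positivity) ht.1

lemma polar (d : ℕ) (hd : 2 ≤ d) (β : Fin d → ℝ) (h : (Fin d → ℝ) → ℝ≥0∞) (hh : Measurable h) :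
    ∫⁻ x in {x : Fin d → ℝ | ∀ i, 0 < x i}, h x * ENNReal.ofReal (∏ i, x i ^ β i) ≤
      2 * ∫⁻ z in annu d, ENNReal.ofReal (∏ i, z i ^ β i) *
        ∫⁻ t in Set.Ioi (0:ℝ), h (t • z) * ENNReal.ofReal (t ^ (d + (∑ i, β i) - 1)) := by
  set w : (Fin d → ℝ) → ℝ≥0∞ := fun x => ENNReal.ofReal (∏ i, x i ^ β i) with hw
  have hwm : Measurable w := by fun_prop
  have hind : Measurable ((annu d).indicator (1 : (Fin d → ℝ) → ℝ≥0∞)) :=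
    Measurable.indicator measurable_one (meas_annu d)
  have hsm : Measurable (fun p : (Fin d → ℝ) × ℝ => p.2⁻¹ • p.1) := by fun_prop
  have hind2 : Measurable (fun p : (Fin d → ℝ) × ℝ => (annu d).indicator (1 : (Fin d → ℝ) → ℝ≥0∞) (p.2⁻¹ • p.1)) :=
    hind.comp hsm
  have hsm' : Measurable (fun p : (Fin d → ℝ) × ℝ => p.2 • p.1) := by fun_prop
  have hh2 : Measurable (fun p : (Fin d → ℝ) × ℝ => h (p.2 • p.1)) := hh.comp hsm'
  calc ∫⁻ x in {x : Fin d → ℝ | ∀ i, 0 < x i}, h x * w x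
      ≤ ∫⁻ x in {x : Fin d → ℝ | ∀ i, 0 < x i}, 2 * ∫⁻ t in Set.Ioi (0:ℝ),
          (h x * w x) * (ENNReal.ofReal t⁻¹ * (annu d).indicator 1 (t⁻¹ • x)) := by
        refine setLIntegral_mono' (meas_pos d) fun x hx => ?_
        rw [lintegral_const_mul]
        · calc h x * w x = h x * w x * 1 := (mul_one _).symm
            _ ≤ h x * w x * _ := mul_le_mul_right (half_bound d hd x hx) _
            _ = _ := by ring
        · exact Measurable.mul (by fun_prop) (hind2.comp measurable_prodMk_left)
    _ ≤ ∫⁻ x, 2 * ∫⁻ t in Set.Ioi (0:ℝ),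
          (h x * w x) * (ENNReal.ofReal t⁻¹ * (annu d).indicator 1 (t⁻¹ • x)) := setLIntegral_le_lintegral _ _
    _ = 2 * ∫⁻ x, ∫⁻ t in Set.Ioi (0:ℝ),
          (h x * w x) * (ENNReal.ofReal t⁻¹ * (annu d).indicator 1 (t⁻¹ • x)) :=
        lintegral_const_mul' _ _ (by norm_num)
    _ = 2 * ∫⁻ t in Set.Ioi (0:ℝ), ∫⁻ x,
          (h x * w x) * (ENNReal.ofReal t⁻¹ * (annu d).indicator 1 (t⁻¹ • x)) := by
        rw [lintegral_lintegral_swap]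
        apply Measurable.aemeasurable
        simp only [Function.uncurry_def]
        exact ((hh.comp measurable_fst).mul (hwm.comp measurable_fst)).mul
          (Measurable.mul (by fun_prop) hind2)
    _ = 2 * ∫⁻ t in Set.Ioi (0:ℝ), ∫⁻ z in annu d, w z * (h (t • z) * ENNReal.ofReal (t ^ (d + (∑ i, β i) - 1))) := by
        congr 1
        refine setLIntegral_congr_fun measurableSet_Ioi fun t ht => ?_
        have ht : 0 < t := ht
        rw [lint_scale d _ (by
          exact (hh.mul hwm).mul (Measurable.mul (by fun_prop) (hind.comp (by fun_prop)))) t ht,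
          ← lintegral_const_mul' _ _ ENNReal.ofReal_ne_top, ← lintegral_indicator (meas_annu d)]
        congr 1
        ext z
        rw [smul_smul, inv_mul_cancel₀ ht.ne', one_smul]
        by_cases hz : z ∈ annu d
        · rw [Set.indicator_of_mem hz, Set.indicator_of_mem hz]
          have e1 : w (t • z) = ENNReal.ofReal (t ^ (∑ i, β i)) * w z := by
            simp only [hw, Pi.smul_apply, smul_eq_mul]
            rw [prod_rpow_smul d β t ht z hz.1, ENNReal.ofReal_mul (by positivity)]
          have e2 : ENNReal.ofReal (t ^ (d + (∑ i, β i) - 1)) =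
              ENNReal.ofReal (t ^ d) * ENNReal.ofReal (t ^ (∑ i, β i)) * ENNReal.ofReal t⁻¹ := by
            rw [← ENNReal.ofReal_mul (by positivity), ← ENNReal.ofReal_mul (by positivity),
              Real.rpow_sub ht, Real.rpow_add ht, Real.rpow_one, Real.rpow_natCast]
            rfl
          rw [e1, e2, Pi.one_apply]
          ring
        · rw [Set.indicator_of_notMem hz, Set.indicator_of_notMem hz]
          simp
    _ = 2 * ∫⁻ z in annu d, ∫⁻ t in Set.Ioi (0:ℝ), w z * (h (t • z) * ENNReal.ofReal (t ^ (d + (∑ i, β i) - 1))) := by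
        rw [lintegral_lintegral_swap]
        apply Measurable.aemeasurable
        simp only [Function.uncurry_def]
        exact (hwm.comp measurable_snd).mul ((hh2.comp measurable_swap).mul (by fun_prop))
    _ = _ := by
        congr 1
        refine lintegral_congr fun z => ?_
        rw [lintegral_const_mul' _ _ ENNReal.ofReal_ne_top]

lemma exp_tail (a t0 : ℝ) (ha : 0 < a) (ht0 : 0 ≤ t0) :
    ∫⁻ t in Set.Ioi t0, ENNReal.ofReal (t * Real.exp (-(a * t^2))) =
      ENNReal.ofReal (Real.exp (-(a * t0 ^ 2)) / (2 * a)) := by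
  have hd : ∀ x ∈ Set.Ici t0, HasDerivAt (fun t => -(Real.exp (-(a * t^2)) / (2 * a))) (x * Real.exp (-(a * x^2))) x := by
    intro x _
    have h1 : HasDerivAt (fun t : ℝ => -(a * t^2)) (-(a * (2 * x))) x := by
      have := ((hasDerivAt_pow 2 x).const_mul a).fun_neg
      exact this.congr_deriv (by norm_num)
    refine ((h1.exp).div_const (2*a)).fun_neg.congr_deriv ?_
    field_simp
  have hn : ∀ x ∈ Set.Ioi t0, 0 ≤ x * Real.exp (-(a * x^2)) := fun x hx => by
    have : t0 < x := hx
    have : 0 < x := by linarith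
    positivity
  have hl : Filter.Tendsto (fun t => -(Real.exp (-(a * t^2)) / (2 * a))) Filter.atTop (nhds (-(0/(2*a)))) := by
    refine ((Real.tendsto_exp_atBot.comp ?_).div_const _).neg
    apply Filter.tendsto_neg_atTop_atBot.comp
    exact (Filter.tendsto_pow_atTop two_ne_zero).const_mul_atTop ha
  rw [← ofReal_integral_eq_lintegral_ofReal (integrableOn_Ioi_deriv_of_nonneg' hd hn hl),
    integral_Ioi_of_hasDerivAt_of_nonneg' hd hn hl]
  · congr 1; ring
  · filter_upwards [ae_restrict_mem measurableSet_Ioi] with x hx using hn x hx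

lemma exp_level (a lam : ℝ) (ha : 0 < a) (hl : 0 < lam) (Q : ℝ≥0∞) :
    ∫⁻ t in Set.Ioi (0:ℝ), {t | ENNReal.ofReal lam < ENNReal.ofReal (Real.exp (a * t^2)) * Q}.indicator
      (fun t => ENNReal.ofReal (t * Real.exp (-(a * t^2)))) t ≤ Q / ENNReal.ofReal (2 * a * lam) := by
  by_cases hQ : Q = ∞
  · rw [hQ, ENNReal.top_div_of_ne_top ENNReal.ofReal_ne_top]; exact le_top
  by_cases hQ0 : Q = 0
  · simp [hQ0]
  obtain ⟨q, hq, rfl⟩ : ∃ q : ℝ, 0 < q ∧ Q = ENNReal.ofReal q :=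
    ⟨Q.toReal, ENNReal.toReal_pos hQ0 hQ, (ENNReal.ofReal_toReal hQ).symm⟩
  set t0 := Real.sqrt (Real.log (lam / q) / a) with ht0
  have ht00 : 0 ≤ t0 := Real.sqrt_nonneg _
  calc _ ≤ ∫⁻ t in Set.Ioi (0:ℝ), (Set.Ioi t0).indicator (fun t => ENNReal.ofReal (t * Real.exp (-(a * t^2)))) t := by
        refine setLIntegral_mono' measurableSet_Ioi fun t ht => ?_
        have ht : 0 < t := ht
        by_cases hmem : ENNReal.ofReal lam < ENNReal.ofReal (Real.exp (a * t^2)) * ENNReal.ofReal q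
        · have hmem2 : t0 < t := by
            rw [ht0, Real.sqrt_lt' ht, div_lt_iff₀ ha, Real.log_lt_iff_lt_exp (by positivity), div_lt_iff₀ hq]
            rw [← ENNReal.ofReal_mul (by positivity), ENNReal.ofReal_lt_ofReal_iff (by positivity)] at hmem
            rwa [mul_comm (t^2) a]
          rw [Set.indicator_of_mem (show t ∈ {t | ENNReal.ofReal lam < ENNReal.ofReal (Real.exp (a * t^2)) * ENNReal.ofReal q} from hmem), Set.indicator_of_mem (show t ∈ Set.Ioi t0 from hmem2)]
        · rw [Set.indicator_of_notMem (show t ∉ {t | ENNReal.ofReal lam < ENNReal.ofReal (Real.exp (a * t^2)) * ENNReal.ofReal q} from hmem)]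
          exact zero_le
    _ ≤ ∫⁻ t, (Set.Ioi t0).indicator (fun t => ENNReal.ofReal (t * Real.exp (-(a * t^2)))) t :=
        setLIntegral_le_lintegral _ _
    _ = ENNReal.ofReal (Real.exp (-(a * t0 ^ 2)) / (2 * a)) := by
        rw [lintegral_indicator measurableSet_Ioi, exp_tail a t0 ha ht00]
    _ ≤ _ := by
        rw [← ENNReal.ofReal_div_of_pos (by positivity)]
        apply ENNReal.ofReal_le_ofReal
        have h1 : Real.log (lam / q) ≤ a * t0 ^ 2 := by
          by_cases hlog : 0 ≤ Real.log (lam/q) / a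
          · rw [ht0, Real.sq_sqrt hlog]; field_simp; exact le_rfl
          · push Not at hlog
            have : Real.log (lam/q) < 0 := by
              by_contra hc; push Not at hc; exact absurd (div_nonneg hc ha.le) (by linarith)
            have : 0 ≤ a * t0^2 := by positivity
            linarith
        have h2 : Real.exp (-(a * t0^2)) ≤ q / lam := by
          calc _ ≤ Real.exp (-Real.log (lam / q)) := Real.exp_le_exp.2 (by linarith)
            _ = _ := by rw [Real.exp_neg, Real.exp_log (by positivity), inv_div]
        calc _ ≤ q / lam / (2 * a) := by gcongr
          _ = _ := by field_simp


lemma nu_apply (d : ℕ) (α : Fin d → ℝ) (S : Set (Fin d → ℝ)) (hS : MeasurableSet S) :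
    nu d α S = ∫⁻ x in {x : Fin d → ℝ | ∀ i, 0 < x i},
      (S.indicator (fun x => ENNReal.ofReal (Real.exp (-(enr d x ^ 2)))) x) *
        ENNReal.ofReal (∏ i, x i ^ (2 * α i + 1)) := by
  rw [nu, Measure.restrict_apply hS, withDensity_apply _ (hS.inter (meas_pos d)), Set.inter_comm,
    ← Measure.restrict_restrict' hS, Measure.restrict_restrict (meas_pos d), Set.inter_comm, ← Measure.restrict_restrict hS,
    ← lintegral_indicator hS]
  refine setLIntegral_congr_fun (meas_pos d) fun x hx => ?_
  by_cases h : x ∈ S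
  · rw [Set.indicator_of_mem h, Set.indicator_of_mem h, ← ENNReal.ofReal_mul (by positivity), enr_sq, mul_comm]
  · rw [Set.indicator_of_notMem h, Set.indicator_of_notMem h, zero_mul]

lemma exists_tail (d : ℕ) (α : Fin d → ℝ) (hα : ∀ i, -1 < α i) :
    ∃ C : ℝ≥0∞, C ≠ ∞ ∧ ∀ L : ℝ, nu d α {x | 2 * L ≤ enr d x ^ 2} ≤ C * ENNReal.ofReal (Real.exp (-L)) := by
  let g : Fin d → ℝ → ℝ≥0∞ := fun i => (Set.Ioi (0:ℝ)).indicator fun u =>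
    ENNReal.ofReal (u ^ (2 * α i + 1) * Real.exp (-(1/2) * u ^ 2))
  have hg : ∀ i, Measurable (g i) := fun i => Measurable.indicator (by fun_prop) measurableSet_Ioi
  refine ⟨∏ i, ∫⁻ u, g i u, ?_, fun L => ?_⟩
  · refine ENNReal.prod_ne_top fun i _ => ?_
    simp only [g]
    rw [lintegral_indicator measurableSet_Ioi]
    exact (integrableOn_rpow_mul_exp_neg_mul_sq (by norm_num) (by linarith [hα i])).lintegral_lt_top.ne
  · have hS : MeasurableSet {x : Fin d → ℝ | 2 * L ≤ enr d x ^ 2} :=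
      measurableSet_le measurable_const ((meas_enr d).pow_const 2)
    rw [nu_apply d α _ hS, ← lintegral_pi_prod d g hg, ← lintegral_mul_const _ (by fun_prop)]
    refine (setLIntegral_mono' (meas_pos d) fun x hx => ?_).trans (setLIntegral_le_lintegral _ _)
    by_cases h : x ∈ {x : Fin d → ℝ | 2 * L ≤ enr d x ^ 2}
    · have h' : 2 * L ≤ enr d x ^ 2 := h
      rw [Set.indicator_of_mem h]
      have e : ∀ i, g i (x i) = ENNReal.ofReal (x i ^ (2 * α i + 1) * Real.exp (-(1/2) * x i ^ 2)) :=
        fun i => Set.indicator_of_mem (show x i ∈ Set.Ioi (0:ℝ) from hx i) _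
      rw [Finset.prod_congr rfl fun i _ => e i, ← ENNReal.ofReal_prod_of_nonneg, ← ENNReal.ofReal_mul (by positivity),
        ← ENNReal.ofReal_mul]
      · apply ENNReal.ofReal_le_ofReal
        rw [Finset.prod_mul_distrib, ← Real.exp_sum, ← Finset.mul_sum, ← enr_sq, mul_assoc, ← Real.exp_add, mul_comm]
        have : 0 ≤ ∏ i, x i ^ (2 * α i + 1) := Finset.prod_nonneg fun i _ => by have := hx i; positivity
        refine mul_le_mul_of_nonneg_left (Real.exp_le_exp.2 ?_) this
        linarith
      · exact Finset.prod_nonneg fun i _ => by have := hx i; positivity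
      · intro i _; have := hx i; positivity
    · rw [Set.indicator_of_notMem h, zero_mul]; exact zero_le

lemma core (d : ℕ) (hd : 2 ≤ d) (α : Fin d → ℝ) (hα : ∀ i, -1 < α i) :
    ∃ C : ℝ≥0∞, C ≠ ∞ ∧ ∀ (μ : Measure (Fin d → ℝ)) [SFinite μ], (∀ᵐ y ∂μ, ∀ i, 0 < y i) →
      ∀ L lam : ℝ, 1 ≤ L → 0 < lam →
      nu d α {x | (Real.sqrt L / 2 ≤ enr d x ∧ enr d x ^ 2 ≤ 2 * L) ∧ ENNReal.ofReal lam <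
        ENNReal.ofReal (Real.exp (enr d x ^ 2)) * ∫⁻ y, ENNReal.ofReal (Wk d (fun i => 2 * α i + 1) (1 / (4 * L)) x y) ∂μ}
        ≤ C * μ Set.univ / ENNReal.ofReal lam := by
  set β : Fin d → ℝ := fun i => 2 * α i + 1 with hβdef
  obtain ⟨C0, hC0, hkey⟩ := key_est d hd β (fun i => by simp only [hβdef]; linarith [hα i])
  set D : ℝ := d + ∑ i, β i with hD
  have hD0 : 0 ≤ D := by
    have : ∑ i, β i ≥ ∑ i : Fin d, (-1:ℝ) := Finset.sum_le_sum fun i _ => by simp only [hβdef]; linarith [hα i]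
    simp at this
    linarith
  set K3 : ℝ := (Real.sqrt 2 * 4) ^ D * 16 with hK3
  have hK30 : 0 ≤ K3 := by positivity
  refine ⟨2 * (ENNReal.ofReal (4 * K3) * C0), ENNReal.mul_ne_top (by norm_num) (ENNReal.mul_ne_top ENNReal.ofReal_ne_top hC0), ?_⟩
  intro μ _ hμ L lam hL hlam
  set s : ℝ := 1 / (4 * L) with hs
  have hs0 : 0 < s := by positivity
  have hs1 : s ≤ 1 := by rw [hs, div_le_one (by positivity)]; linarith
  set G : (Fin d → ℝ) → ℝ≥0∞ := fun x => ∫⁻ y, ENNReal.ofReal (Wk d β s x y) ∂μ with hG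
  have hWm := (meas_Wk d β s).ennreal_ofReal
  have hGm : Measurable G := Measurable.lintegral_prod_right' hWm
  have hem := meas_enr d
  set S : Set (Fin d → ℝ) := {x | (Real.sqrt L / 2 ≤ enr d x ∧ enr d x ^ 2 ≤ 2 * L) ∧ ENNReal.ofReal lam <
        ENNReal.ofReal (Real.exp (enr d x ^ 2)) * G x} with hS
  have hm1 : Measurable (fun x : Fin d → ℝ => enr d x ^ 2) := by fun_prop
  have hm2 : Measurable (fun x : Fin d → ℝ => ENNReal.ofReal (Real.exp (enr d x ^ 2)) * G x) := by fun_prop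
  have hSm : MeasurableSet S := by
    refine MeasurableSet.inter (MeasurableSet.inter ?_ ?_) ?_
    · exact measurableSet_le measurable_const hem
    · exact measurableSet_le hm1 measurable_const
    · exact measurableSet_lt measurable_const hm2
  rw [nu_apply d α S hSm]
  set h : (Fin d → ℝ) → ℝ≥0∞ := S.indicator (fun x => ENNReal.ofReal (Real.exp (-(enr d x ^ 2)))) with hh
  have hhm : Measurable h := Measurable.indicator (by fun_prop) hSm
  refine (polar d hd β h hhm).trans ?_
  have hL0 : 0 < L := by linarith
  have hsL : 0 < Real.sqrt L := Real.sqrt_pos.2 hL0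
  have inner : ∀ z ∈ annu d, ∫⁻ t in Set.Ioi (0:ℝ), h (t • z) * ENNReal.ofReal (t ^ (D - 1)) ≤
      ENNReal.ofReal (4 * K3) * ENNReal.ofReal s * G z / ENNReal.ofReal lam := by
    intro z hz
    obtain ⟨hz0, hz1, hz2⟩ := hz
    set a := enr d z ^ 2 with ha
    have ha1 : 1 ≤ a := by nlinarith
    set Q : ℝ≥0∞ := ENNReal.ofReal ((Real.sqrt L / 4) ^ (-D)) * G z with hQ
    set K2 : ℝ := (Real.sqrt (2 * L)) ^ D * (16 / L) with hK2
    calc _ ≤ ∫⁻ t in Set.Ioi (0:ℝ), ENNReal.ofReal K2 * {t | ENNReal.ofReal lam < ENNReal.ofReal (Real.exp (a * t^2)) * Q}.indicator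
              (fun t => ENNReal.ofReal (t * Real.exp (-(a * t^2)))) t := by
          refine setLIntegral_mono' measurableSet_Ioi fun t ht => ?_
          have ht : 0 < t := ht
          by_cases hm : t • z ∈ S
          · rw [hh, Set.indicator_of_mem hm]
            obtain ⟨⟨m1, m2⟩, m3⟩ := hm
            rw [enr_smul d t ht.le] at m1 m2 m3 ⊢
            have t1 : Real.sqrt L / 4 ≤ t := by nlinarith
            have t2 : t ≤ Real.sqrt (2 * L) := by
              apply Real.le_sqrt_of_sq_le
              have : t ^ 2 ≤ (t * enr d z) ^ 2 := by
                apply pow_le_pow_left₀ ht.le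
                exact le_mul_of_one_le_right ht.le hz1.le
              linarith
            have ee : (t * enr d z) ^ 2 = a * t ^ 2 := by rw [ha]; ring
            rw [ee] at m3 ⊢
            have gz : G (t • z) = ENNReal.ofReal (t ^ (-D)) * G z := by
              simp only [hG]
              rw [← lintegral_const_mul' _ _ ENNReal.ofReal_ne_top]
              congr 1
              ext y
              rw [Wk_smul d β s hs0 t ht z y hz0, ENNReal.ofReal_mul (by positivity)]
            have gz2 : G (t • z) ≤ Q := by
              rw [gz, hQ]
              refine mul_le_mul_left (ENNReal.ofReal_le_ofReal ?_) _
              exact Real.rpow_le_rpow_of_nonpos (by positivity) t1 (by linarith)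
            have mem : t ∈ {t | ENNReal.ofReal lam < ENNReal.ofReal (Real.exp (a * t^2)) * Q} :=
              m3.trans_le (mul_le_mul_right gz2 _)
            rw [Set.indicator_of_mem mem, ← ENNReal.ofReal_mul (by positivity), ← ENNReal.ofReal_mul (by positivity)]
            apply ENNReal.ofReal_le_ofReal
            have p1 : t ^ (D - 1) ≤ K2 * t := by
              have e1 : t ^ (D - 1) = t ^ D * (1 / t ^ 2) * t := by
                rw [Real.rpow_sub ht, Real.rpow_one]; field_simp
              rw [e1, hK2]
              have : 1 / t ^ 2 ≤ 16 / L := by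
                rw [div_le_div_iff₀ (by positivity) hL0]
                have : (Real.sqrt L / 4) ^ 2 ≤ t ^ 2 := pow_le_pow_left₀ (by positivity) t1 2
                rw [div_pow, Real.sq_sqrt hL0.le] at this
                linarith
              gcongr
            calc _ ≤ Real.exp (-(a * t^2)) * (K2 * t) := by gcongr
              _ = _ := by ring
          · rw [hh, Set.indicator_of_notMem hm, zero_mul]; exact zero_le
      _ = ENNReal.ofReal K2 * ∫⁻ t in Set.Ioi (0:ℝ), {t | ENNReal.ofReal lam < ENNReal.ofReal (Real.exp (a * t^2)) * Q}.indicator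
              (fun t => ENNReal.ofReal (t * Real.exp (-(a * t^2)))) t := lintegral_const_mul' _ _ ENNReal.ofReal_ne_top
      _ ≤ ENNReal.ofReal K2 * (Q / ENNReal.ofReal (2 * a * lam)) :=
          mul_le_mul_right (exp_level a lam (by linarith) hlam Q) _
      _ ≤ ENNReal.ofReal K2 * (Q / ENNReal.ofReal lam) := by
          refine mul_le_mul_right (ENNReal.div_le_div_left (ENNReal.ofReal_le_ofReal ?_) _) _
          nlinarith
      _ = _ := by
          rw [hQ, ← mul_div_assoc, ← mul_assoc, ← ENNReal.ofReal_mul (by positivity), ← ENNReal.ofReal_mul (by positivity)]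
          congr 3
          rw [hK2, hs, hK3, Real.sqrt_mul (by norm_num), Real.rpow_neg (by positivity), Real.mul_rpow (by positivity) (by positivity),
            Real.mul_rpow (by positivity) (by positivity), Real.div_rpow (by positivity) (by positivity)]
          field_simp
  have dbl : ENNReal.ofReal s * ∫⁻ z in annu d, ENNReal.ofReal (∏ i, z i ^ β i) * G z ≤ C0 * μ Set.univ := by
    calc _ = ENNReal.ofReal s * ∫⁻ z in annu d, ∫⁻ y, ENNReal.ofReal (Wk d β s z y * ∏ i, z i ^ β i) ∂μ := by
          congr 1
          refine setLIntegral_congr_fun (meas_annu d) fun z hz => ?_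
          simp only [hG]
          rw [← lintegral_const_mul' _ _ ENNReal.ofReal_ne_top]
          refine lintegral_congr fun y => ?_
          rw [mul_comm, ENNReal.ofReal_mul' (Finset.prod_nonneg fun i _ => by have := hz.1 i; positivity)]
      _ = ENNReal.ofReal s * ∫⁻ y, ∫⁻ z in annu d, ENNReal.ofReal (Wk d β s z y * ∏ i, z i ^ β i) ∂volume ∂μ := by
          rw [lintegral_lintegral_swap]
          apply Measurable.aemeasurable
          simp only [Function.uncurry_def]
          exact ((meas_Wk d β s).mul (by fun_prop)).ennreal_ofReal
      _ = ∫⁻ y, ENNReal.ofReal s * ∫⁻ z in annu d, ENNReal.ofReal (Wk d β s z y * ∏ i, z i ^ β i) ∂volume ∂μ :=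
          (lintegral_const_mul' _ _ ENNReal.ofReal_ne_top).symm
      _ ≤ ∫⁻ _y, C0 ∂μ := by
          refine lintegral_mono_ae ?_
          filter_upwards [hμ] with y hy using hkey y hy s hs0 hs1
      _ = _ := lintegral_const _
  calc _ ≤ 2 * ∫⁻ z in annu d, ENNReal.ofReal (∏ i, z i ^ β i) *
            (ENNReal.ofReal (4 * K3) * ENNReal.ofReal s * G z / ENNReal.ofReal lam) := by
        refine mul_le_mul_right (setLIntegral_mono' (meas_annu d) fun z hz => ?_) _
        exact mul_le_mul_right (inner z hz) _
    _ = 2 * ∫⁻ z in annu d, (ENNReal.ofReal (4 * K3) * ENNReal.ofReal s * (ENNReal.ofReal lam)⁻¹) *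
          (ENNReal.ofReal (∏ i, z i ^ β i) * G z) := by
        congr 2; ext z; rw [div_eq_mul_inv]; ring
    _ = 2 * ENNReal.ofReal (4 * K3) * (ENNReal.ofReal lam)⁻¹ * (ENNReal.ofReal s * ∫⁻ z in annu d, ENNReal.ofReal (∏ i, z i ^ β i) * G z) := by
        rw [lintegral_const_mul _ (by fun_prop)]
        ring
    _ ≤ 2 * ENNReal.ofReal (4 * K3) * (ENNReal.ofReal lam)⁻¹ * (C0 * μ Set.univ) := mul_le_mul_right dbl _
    _ = _ := by rw [div_eq_mul_inv]; ring


lemma V_anti {x T1 T2 β : ℝ} (hx : 0 < x) (h1 : 0 < T1) (h : T1 ≤ T2) (hβ : -1 < β) :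
    T2⁻¹ * (x + T2) ^ (-β) ≤ T1⁻¹ * (x + T1) ^ (-β) := by
  have h2 : 0 < T2 := h1.trans_le h
  by_cases hb : 0 ≤ β
  · refine mul_le_mul (inv_anti₀ h1 h) ?_ (by positivity) (by positivity)
    exact Real.rpow_le_rpow_of_nonpos (by positivity) (by linarith) (by linarith)
  · push Not at hb
    have key := phi_anti (t1 := T1) (t2 := T2) (u := x) (b := -β) (ε := 0) h1 h hx (by linarith) (by linarith) le_rfl
    have e : ∀ T : ℝ, 0 < T → T⁻¹ * (x + T) ^ (-β) = x ^ (-β) * (T ^ (-1 - (0:ℝ)) * (1 + T / x) ^ (-β)) := by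
      intro T hT
      rw [sub_zero, Real.rpow_neg_one, show x + T = x * (1 + T / x) by field_simp, Real.mul_rpow hx.le (by positivity)]
      ring
    rw [e _ h1, e _ h2]
    gcongr

lemma V_anti_prod (d : ℕ) (β x : Fin d → ℝ) {T1 T2 : ℝ} (hx : ∀ i, 0 < x i) (h1 : 0 < T1) (h : T1 ≤ T2) (hβ : ∀ i, -1 < β i) :
    T2 ^ (-(d:ℝ)) * ∏ i, (x i + T2) ^ (-β i) ≤ T1 ^ (-(d:ℝ)) * ∏ i, (x i + T1) ^ (-β i) := by
  have h2 : 0 < T2 := h1.trans_le h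
  have e : ∀ T : ℝ, 0 < T → T ^ (-(d:ℝ)) * ∏ i, (x i + T) ^ (-β i) = ∏ i, (T⁻¹ * (x i + T) ^ (-β i)) := by
    intro T hT
    rw [Finset.prod_mul_distrib, Finset.prod_const, Finset.card_univ, Fintype.card_fin, Real.rpow_neg hT.le, Real.rpow_natCast, inv_pow]
  rw [e _ h1, e _ h2]
  refine Finset.prod_le_prod (fun i _ => by have := hx i; positivity) fun i _ => V_anti (hx i) h1 h (hβ i)

lemma minker_le_Wk (d : ℕ) (hd : 2 ≤ d) (α : Fin d → ℝ) (hα : ∀ i, -1 < α i) (s : ℝ) (hs : 0 < s) (x y : Fin d → ℝ)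
    (hx : ∀ i, 0 < x i) (hr : enr d x * (enr d x + 1) * s ≤ 1) :
    minker d α x y ≤ ENNReal.ofReal (Wk d (fun i => 2 * α i + 1) s x y) := by
  have hr0 : 0 < enr d x := (hx ⟨0, by omega⟩).trans_le (le_enr d x _)
  unfold Wk
  have hth : 0 ≤ theta d x y := Real.arccos_nonneg _
  set r := enr d x
  set θ := theta d x y with hθ
  have hrs : r * s ≤ 1 / (r + 1) := by
    rw [le_div_iff₀ (by positivity)]; linarith
  by_cases hc : 1 / (r + 1) ≤ r * θ
  · refine (min_le_left _ _).trans (le_of_eq ?_)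
    have hsθ : s ≤ θ := by
      have := hrs.trans hc
      exact le_of_mul_le_mul_left this hr0
    have hT : 0 < r * θ := lt_of_lt_of_le (by positivity) hc
    rw [max_eq_left hsθ, ENNReal.ofReal_mul (p := (r * θ) ^ (-(d:ℝ))) (by positivity), ENNReal.ofReal_prod_of_nonneg (fun i _ => by have := hx i; positivity),
      ← ENNReal.ofReal_rpow_of_pos hT]
    congr 1
    refine Finset.prod_congr rfl fun i _ => ?_
    rw [ENNReal.ofReal_rpow_of_pos (by have := hx i; positivity)]
  · push Not at hc
    refine (min_le_right _ _).trans (ENNReal.ofReal_le_ofReal ?_)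
    have hM : 0 < max θ s := lt_max_of_lt_right hs
    have := V_anti_prod d (fun i => 2 * α i + 1) x hx (T1 := r * max θ s) (T2 := 1 / (r + 1)) (by positivity) (by
      rw [mul_max_of_nonneg _ _ hr0.le]
      exact max_le hc.le hrs) (fun i => by linarith [hα i])
    refine le_trans (le_of_eq ?_) this
    congr 1
    rw [one_div, Real.inv_rpow (by positivity), Real.rpow_neg (by positivity), inv_inv, Real.rpow_natCast]

lemma minker_le_pow (d : ℕ) (α : Fin d → ℝ) (x y : Fin d → ℝ) (hx : ∀ i, 0 < x i) :
    minker d α x y ≤ ENNReal.ofReal ((enr d x + 1) ^ (d + ∑ i, |2 * α i + 1|)) := by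
  refine (min_le_right _ _).trans (ENNReal.ofReal_le_ofReal ?_)
  have hr0 := enr_nonneg d x
  set r := enr d x with hr
  have h1 : 1 ≤ r + 1 := by linarith
  rw [Real.rpow_add (by positivity), Real.rpow_natCast, Real.rpow_sum_of_pos (by positivity)]
  refine mul_le_mul_of_nonneg_left ?_ (by positivity)
  refine Finset.prod_le_prod (fun i _ => by have := hx i; positivity) fun i _ => ?_
  have hxi := hx i
  by_cases hb : 0 ≤ 2 * α i + 1
  · rw [abs_of_nonneg hb]
    calc _ ≤ (1 / (r + 1)) ^ (-(2 * α i + 1)) :=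
          Real.rpow_le_rpow_of_nonpos (by positivity) (by linarith) (by linarith)
      _ = _ := by rw [one_div, Real.inv_rpow (by positivity), Real.rpow_neg (by positivity), inv_inv]
  · push Not at hb
    rw [abs_of_neg hb]
    refine Real.rpow_le_rpow (by positivity) ?_ (by linarith)
    have : 1 / (r + 1) ≤ 1 := by rw [div_le_one (by positivity)]; exact h1
    have := le_enr d x i
    linarith

lemma nu_pos (d : ℕ) (α : Fin d → ℝ) : ∀ᵐ x ∂(nu d α), ∀ i, 0 < x i :=
  ae_restrict_mem (meas_pos d)

lemma final (d : ℕ) (hd : 2 ≤ d) (α : Fin d → ℝ) (hα : ∀ i, -1 < α i) :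
    ∃ C : ℝ≥0∞, C ≠ ∞ ∧ ∀ F : (Fin d → ℝ) → ℝ≥0∞, AEMeasurable F (nu d α) →
      ∫⁻ y, F y ∂(nu d α) ≠ ∞ → ∀ lam : ℝ, 0 < lam →
      nu d α {x | ENNReal.ofReal lam <
          ENNReal.ofReal (Real.exp (enr d x ^ 2)) *
            ∫⁻ y, minker d α x y * F y ∂(nu d α)} ≤ C * (∫⁻ y, F y ∂(nu d α)) / ENNReal.ofReal lam := by
  obtain ⟨C1, hC1, htail⟩ := exists_tail d α hα
  obtain ⟨C2, hC2, hcore⟩ := core d hd α hα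
  set P : ℝ := d + ∑ i, |2 * α i + 1| with hP
  have hP0 : 0 ≤ P := by positivity
  set L0 : ℝ := max 1 (P ^ 2) with hL0
  refine ⟨C1 * ENNReal.ofReal (Real.exp L0) + (C1 + C2),
    by simp [ENNReal.mul_eq_top, hC1, hC2], ?_⟩
  intro F hF hFi lam hlam
  set E := {x | ENNReal.ofReal lam < ENNReal.ofReal (Real.exp (enr d x ^ 2)) *
            ∫⁻ y, minker d α x y * F y ∂(nu d α)} with hE
  set M := ∫⁻ y, F y ∂(nu d α) with hM
  have hbd : ∀ x, (∀ i, 0 < x i) → ∫⁻ y, minker d α x y * F y ∂(nu d α) ≤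
      ENNReal.ofReal ((enr d x + 1) ^ P) * M := by
    intro x hx
    rw [hM, ← lintegral_const_mul' _ _ ENNReal.ofReal_ne_top]
    exact lintegral_mono fun y => mul_le_mul_left (minker_le_pow d α x y hx) _
  by_cases hM0 : M = 0
  · have : nu d α E = 0 := by
      rw [← compl_compl E, ← mem_ae_iff]
      filter_upwards [nu_pos d α] with x hx
      have := hbd x hx
      rw [hM0, mul_zero] at this
      simp only [hE, Set.mem_compl_iff, Set.mem_ofPred_eq, not_lt]
      rw [le_zero_iff.1 this, mul_zero]; exact zero_le
    rw [this]; exact zero_le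
  have hm : 0 < M.toReal := ENNReal.toReal_pos hM0 hFi
  have hMm : M = ENNReal.ofReal M.toReal := (ENNReal.ofReal_toReal hFi).symm
  set m := M.toReal
  set L := Real.log (lam / m) with hL
  have hexp : Real.exp L = lam / m := Real.exp_log (by positivity)
  have hMlam : M / ENNReal.ofReal lam = ENNReal.ofReal (Real.exp (-L)) := by
    rw [Real.exp_neg, hexp, inv_div, ENNReal.ofReal_div_of_pos hlam, ← hMm]
  rw [mul_div_assoc, hMlam]
  by_cases hLL : L ≤ L0
  · calc nu d α E ≤ nu d α {x | 2 * 0 ≤ enr d x ^ 2} := measure_mono fun x _ => by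
          show (2 * 0 : ℝ) ≤ enr d x ^ 2
          rw [mul_zero]; positivity
      _ ≤ C1 * ENNReal.ofReal (Real.exp (-0)) := htail 0
      _ ≤ C1 * (ENNReal.ofReal (Real.exp L0) * ENNReal.ofReal (Real.exp (-L))) := by
          refine mul_le_mul_right ?_ _
          rw [← ENNReal.ofReal_mul (by positivity), ← Real.exp_add]
          exact ENNReal.ofReal_le_ofReal (Real.exp_le_exp.2 (by linarith))
      _ = (C1 * ENNReal.ofReal (Real.exp L0)) * ENNReal.ofReal (Real.exp (-L)) := by ring
      _ ≤ _ := mul_le_mul_left le_self_add _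
  push Not at hLL
  have hL1 : 1 ≤ L := (le_max_left _ _).trans hLL.le
  have hLP : P ^ 2 ≤ L := (le_max_right _ _).trans hLL.le
  set μ := (nu d α).withDensity F with hμ
  have hμu : μ Set.univ = M := by rw [hμ, withDensity_apply _ MeasurableSet.univ, Measure.restrict_univ]
  have : IsFiniteMeasure μ := ⟨by rw [hμu]; exact hFi.lt_top⟩
  have hμpos : ∀ᵐ y ∂μ, ∀ i, 0 < y i := (withDensity_absolutelyContinuous _ _).ae_le (nu_pos d α)
  set S := {x | (Real.sqrt L / 2 ≤ enr d x ∧ enr d x ^ 2 ≤ 2 * L) ∧ ENNReal.ofReal lam <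
        ENNReal.ofReal (Real.exp (enr d x ^ 2)) * ∫⁻ y, ENNReal.ofReal (Wk d (fun i => 2 * α i + 1) (1 / (4 * L)) x y) ∂μ} with hS
  have hsub : nu d α E ≤ nu d α ({x | 2 * L ≤ enr d x ^ 2} ∪ S) := by
    refine measure_mono_ae ?_
    filter_upwards [nu_pos d α] with x hx hxE
    have hxE : ENNReal.ofReal lam < ENNReal.ofReal (Real.exp (enr d x ^ 2)) *
            ∫⁻ y, minker d α x y * F y ∂(nu d α) := hxE
    by_cases h2 : 2 * L ≤ enr d x ^ 2
    · exact Or.inl h2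
    push Not at h2
    right
    have hr0 := enr_nonneg d x
    refine ⟨⟨?_, h2.le⟩, ?_⟩
    · by_contra hc
      push Not at hc
      refine absurd hxE (not_lt.2 ?_)
      calc _ ≤ ENNReal.ofReal (Real.exp (enr d x ^ 2)) * (ENNReal.ofReal ((enr d x + 1) ^ P) * M) :=
            mul_le_mul_right (hbd x hx) _
        _ = ENNReal.ofReal (Real.exp (enr d x ^ 2) * ((enr d x + 1) ^ P * m)) := by
            rw [hMm, ← ENNReal.ofReal_mul (by positivity), ← ENNReal.ofReal_mul (by positivity)]
        _ ≤ ENNReal.ofReal lam := by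
            apply ENNReal.ofReal_le_ofReal
            set r := enr d x
            have e1 : (r + 1) ^ P ≤ Real.exp (r * P) := by
              rw [Real.exp_mul]
              exact Real.rpow_le_rpow (by positivity) (Real.add_one_le_exp r) hP0
            have hsq : Real.sqrt L ^ 2 = L := Real.sq_sqrt (by linarith)
            have hs0 := Real.sqrt_nonneg L
            have hPs : P ≤ Real.sqrt L := Real.le_sqrt_of_sq_le hLP
            have e2 : r ^ 2 + r * P ≤ L := by nlinarith
            calc _ ≤ Real.exp (r ^ 2) * (Real.exp (r * P) * m) := by gcongr
              _ = Real.exp (r ^ 2 + r * P) * m := by rw [Real.exp_add]; ring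
              _ ≤ Real.exp L * m := by gcongr
              _ = lam := by rw [hexp]; field_simp
    · refine hxE.trans_le (mul_le_mul_right ?_ _)
      have hWm : Measurable (fun y => ENNReal.ofReal (Wk d (fun i => 2 * α i + 1) (1 / (4 * L)) x y)) :=
        ((meas_Wk d (fun i => 2 * α i + 1) (1 / (4 * L))).comp measurable_prodMk_left).ennreal_ofReal
      rw [hμ, lintegral_withDensity_eq_lintegral_mul₀ hF hWm.aemeasurable]
      refine lintegral_mono fun y => ?_
      simp only [Pi.mul_apply]
      rw [mul_comm]
      refine mul_le_mul_right (minker_le_Wk d hd α hα _ (by positivity) x y hx ?_) _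
      rw [mul_one_div, div_le_one (by positivity)]
      nlinarith
  calc _ ≤ _ := hsub
    _ ≤ nu d α {x | 2 * L ≤ enr d x ^ 2} + nu d α S := measure_union_le _ _
    _ ≤ C1 * ENNReal.ofReal (Real.exp (-L)) + C2 * ENNReal.ofReal (Real.exp (-L)) := by
        refine add_le_add (htail L) ((hcore μ hμpos L lam hL1 hlam).trans (le_of_eq ?_))
        rw [hμu, mul_div_assoc, hMlam]
    _ = (C1 + C2) * ENNReal.ofReal (Real.exp (-L)) := by ring
    _ ≤ _ := mul_le_mul_left le_add_self _

theorem stmt8 (d : ℕ) (hd : 2 ≤ d) (α : Fin d → ℝ) (hα : ∀ i, -1 < α i) :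
    ∃ C : ℝ, 0 < C ∧ ∀ f : (Fin d → ℝ) → ℝ, (∀ x, 0 ≤ f x) →
      Integrable f (nu d α) → ∀ lam : ℝ, 0 < lam →
      nu d α {x | ENNReal.ofReal lam <
          ENNReal.ofReal (Real.exp (enr d x ^ 2)) *
            ∫⁻ y, minker d α x y * ENNReal.ofReal (f y) ∂(nu d α)} ≤
        ENNReal.ofReal (C / lam * ∫ x, f x ∂(nu d α)) := by
  obtain ⟨C, hC, h⟩ := final d hd α hα
  refine ⟨C.toReal + 1, by positivity, ?_⟩
  intro f hf hfi lam hlam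
  have e := ofReal_integral_eq_lintegral_ofReal hfi (Filter.Eventually.of_forall hf)
  refine (h (fun y => ENNReal.ofReal (f y)) hfi.1.aemeasurable.ennreal_ofReal (by rw [← e]; exact ENNReal.ofReal_ne_top) lam hlam).trans ?_
  have hI : 0 ≤ ∫ x, f x ∂(nu d α) := integral_nonneg hf
  rw [← e, ← ENNReal.ofReal_toReal hC, ← ENNReal.ofReal_mul (by positivity), ← ENNReal.ofReal_div_of_pos hlam]
  apply ENNReal.ofReal_le_ofReal
  rw [ENNReal.toReal_ofReal (by positivity), div_mul_eq_mul_div]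
  gcongr
  linarith
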